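/- Let G be a finite group with unit e, k a field, and H a Hopf algebra over k. Then H admits a G-cograding (H_p)_{p∈G} with H_p ≠ {0} for all p ∈ G if and only if there exists an injective unital k-algebra homomorphism γ : (G → k) → H (where G → k carries the pointwise algebra structure) such that the image of γ lies in the center of H and Δ(γ(f)) = Σ_{(p,q) ∈ G×G} f(p·q) · (γ(δ_p) ⊗ γ(δ_q)) for every f : G → k, where δ_p : G → k denotes the indicator function of {p}. -/

import Mathlib

noncomputable section

open TensorProduct

/-- A `G`-cograding of a Hopf algebra `H`: a family of submodules whose internal
direct sum is `H`, multiplying to `0` in different components and into themselves in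
equal components, and such that the spans of `Δ(a)(1 ⊗ b)` resp. `(c ⊗ 1)Δ(a)`
recover the image of `H_p ⊗ H_q` in `H ⊗ H`. -/
structure GCograding (k : Type*) [Field k] (G : Type*) [Group G] [DecidableEq G]
    (H : Type*) [Ring H] [HopfAlgebra k H] where
  comp : G → Submodule k H
  internal : DirectSum.IsInternal comp
  mul_eq_zero : ∀ p q : G, p ≠ q → ∀ a ∈ comp p, ∀ b ∈ comp q, a * b = (0 : H)
  mul_mem : ∀ p : G, ∀ a ∈ comp p, ∀ b ∈ comp p, a * b ∈ comp p
  comul_right : ∀ p q : G,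
    Submodule.span k {z : H ⊗[k] H |
        ∃ a ∈ comp (p * q), ∃ b ∈ comp q,
          z = Coalgebra.comul (R := k) a * (1 ⊗ₜ[k] b)}
      = Submodule.span k {z : H ⊗[k] H | ∃ x ∈ comp p, ∃ y ∈ comp q, z = x ⊗ₜ[k] y}
  comul_left : ∀ p q : G,
    Submodule.span k {z : H ⊗[k] H |
        ∃ c ∈ comp p, ∃ a ∈ comp (p * q),
          z = (c ⊗ₜ[k] 1) * Coalgebra.comul (R := k) a}
      = Submodule.span k {z : H ⊗[k] H | ∃ x ∈ comp p, ∃ y ∈ comp q, z = x ⊗ₜ[k] y}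

section Aux

variable {k : Type*} [Field k] {H : Type*} [Ring H] [HopfAlgebra k H]

lemma aux_right {ι : Type*} (x : H) (r : Coalgebra.Repr k x ι) :
    ∑ i ∈ r.index, Coalgebra.comul (R := k) (r.left i) *
      ((1 : H) ⊗ₜ[k] (HopfAlgebra.antipode k (r.right i))) = x ⊗ₜ[k] (1 : H) := by
  let T : H ⊗[k] (H ⊗[k] H) →ₗ[k] H ⊗[k] H :=
    LinearMap.lTensor H (LinearMap.mul' k H ∘ₗ LinearMap.lTensor H (HopfAlgebra.antipode k))
  have hT : ∀ (z : H ⊗[k] H) (c : H), T (TensorProduct.assoc k H H H (z ⊗ₜ[k] c)) =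
      z * ((1 : H) ⊗ₜ[k] (HopfAlgebra.antipode k c)) := by
    intro z c
    induction z using TensorProduct.induction_on with
    | zero => simp
    | tmul a b => simp [T]
    | add a b ha hb => rw [TensorProduct.add_tmul, map_add, map_add, ha, hb, add_mul]
  have h1 := congrArg T (Coalgebra.coassoc_apply (R := k) x)
  have h2 : T (LinearMap.lTensor H (Coalgebra.comul (R := k)) (Coalgebra.comul (R := k) x))
      = x ⊗ₜ[k] (1 : H) := by
    have := congrArg (LinearMap.lTensor H (Algebra.linearMap k H))
      (Coalgebra.lTensor_counit_comul (R := k) x)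
    rw [LinearMap.lTensor_tmul] at this
    simp only [T]
    rw [← LinearMap.comp_apply, ← LinearMap.lTensor_comp, LinearMap.comp_assoc,
      HopfAlgebra.mul_antipode_lTensor_comul, LinearMap.lTensor_comp, LinearMap.comp_apply, this]
    simp
  rw [h2] at h1
  rw [← h1]
  conv_rhs => rw [← r.eq]
  simp only [map_sum, LinearMap.rTensor_tmul, hT]

lemma aux_left {ι : Type*} (x : H) (r : Coalgebra.Repr k x ι) :
    ∑ i ∈ r.index, ((HopfAlgebra.antipode k (r.left i)) ⊗ₜ[k] (1 : H)) *
      Coalgebra.comul (R := k) (r.right i) = (1 : H) ⊗ₜ[k] x := by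
  let T : (H ⊗[k] H) ⊗[k] H →ₗ[k] H ⊗[k] H :=
    LinearMap.rTensor H (LinearMap.mul' k H ∘ₗ LinearMap.rTensor H (HopfAlgebra.antipode k))
  have hT : ∀ (z : H ⊗[k] H) (c : H), T ((TensorProduct.assoc k H H H).symm (c ⊗ₜ[k] z)) =
      ((HopfAlgebra.antipode k c) ⊗ₜ[k] (1 : H)) * z := by
    intro z c
    induction z using TensorProduct.induction_on with
    | zero => simp
    | tmul a b => simp [T]
    | add a b ha hb => rw [TensorProduct.tmul_add, map_add, map_add, ha, hb, mul_add]
  have h1 := congrArg T (Coalgebra.coassoc_symm_apply (R := k) x)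
  have h2 : T (LinearMap.rTensor H (Coalgebra.comul (R := k)) (Coalgebra.comul (R := k) x))
      = (1 : H) ⊗ₜ[k] x := by
    have := congrArg (LinearMap.rTensor H (Algebra.linearMap k H))
      (Coalgebra.rTensor_counit_comul (R := k) x)
    rw [LinearMap.rTensor_tmul] at this
    simp only [T]
    rw [← LinearMap.comp_apply, ← LinearMap.rTensor_comp, LinearMap.comp_assoc,
      HopfAlgebra.mul_antipode_rTensor_comul, LinearMap.rTensor_comp, LinearMap.comp_apply, this]
    simp
  rw [h2] at h1
  rw [← h1]
  conv_rhs => rw [← r.eq]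
  simp only [map_sum, LinearMap.lTensor_tmul, hT]

/-- Multiplying by `u ⊗ v` lands in the image of the tensor product of the fixed spaces. -/
lemma aux_mem (u v : H) (hu : u * u = u) (hv : v * v = v) (A B : Submodule k H)
    (hA : ∀ a, a ∈ A ↔ u * a = a) (hB : ∀ a, a ∈ B ↔ v * a = a) (z : H ⊗[k] H) :
    (u ⊗ₜ[k] v) * z ∈
      Submodule.span k {z : H ⊗[k] H | ∃ x ∈ A, ∃ y ∈ B, z = x ⊗ₜ[k] y} := by
  induction z using TensorProduct.induction_on with
  | zero => simp
  | tmul a b =>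
    apply Submodule.subset_span
    refine ⟨u * a, (hA _).2 (by rw [← mul_assoc, hu]), v * b,
      (hB _).2 (by rw [← mul_assoc, hv]), by simp⟩
  | add a b ha hb => rw [mul_add]; exact add_mem ha hb

variable {G : Type*} [Group G] [DecidableEq G] [Fintype G]

theorem aux_backward (e : G → H) (hcen : ∀ p a, e p * a = a * e p)
    (hid : ∀ p, e p * e p = e p) (horth : ∀ p q, p ≠ q → e p * e q = 0)
    (hsum : ∑ p, e p = 1)
    (hcom : ∀ p q, Coalgebra.comul (R := k) (e (p * q)) * ((1 : H) ⊗ₜ[k] e q) = e p ⊗ₜ[k] e q)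
    (hcom2 : ∀ p q, Coalgebra.comul (R := k) (e (p * q)) * (e p ⊗ₜ[k] (1 : H)) = e p ⊗ₜ[k] e q)
    (hne : ∀ p, e p ≠ 0) :
    ∃ c : GCograding k G H, ∀ p : G, c.comp p ≠ ⊥ := by
  let A : G → Submodule k H := fun p => LinearMap.eqLocus (LinearMap.mulLeft k (e p)) LinearMap.id
  have hA : ∀ p a, a ∈ A p ↔ e p * a = a := fun p a => Iff.rfl
  have hcen2 : ∀ p q (z : H ⊗[k] H), (e p ⊗ₜ[k] e q) * z = z * (e p ⊗ₜ[k] e q) := by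
    intro p q z
    induction z using TensorProduct.induction_on with
    | zero => simp
    | tmul a b => simp [hcen]
    | add a b ha hb => rw [mul_add, add_mul, ha, hb]
  refine ⟨⟨A, ?_, ?_, ?_, ?_, ?_⟩, ?_⟩
  · have key : ∀ (x : DirectSum G fun p => A p) (p : G),
        e p * (DirectSum.coeAddMonoidHom A x) = x p := by
      intro x p
      induction x using DirectSum.induction_on with
      | zero => simp
      | of q a =>
        rw [DirectSum.coeAddMonoidHom_of]
        by_cases h : q = p
        · subst h
          rw [DirectSum.of_eq_same]; exact (hA _ _).1 a.2
        · rw [DirectSum.of_eq_of_ne _ _ _ (Ne.symm h), ← (hA q a).1 a.2, ← mul_assoc,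
            horth _ _ (Ne.symm h)]
          simp
      | add a b ha hb => rw [map_add, mul_add, ha, hb]; rfl
    constructor
    · intro x y hxy
      ext p
      rw [← key, ← key, hxy]
    · intro a
      refine ⟨∑ p, DirectSum.of (fun p => A p) p ⟨e p * a, (hA _ _).2 (by rw [← mul_assoc, hid])⟩, ?_⟩
      rw [map_sum]
      simp only [DirectSum.coeAddMonoidHom_of]
      rw [← Finset.sum_mul, hsum, one_mul]
  · intro p q hpq a ha b hb
    rw [← (hA _ _).1 ha, ← (hA _ _).1 hb, hcen p a, mul_assoc, ← mul_assoc (e p), horth _ _ hpq]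
    simp
  · intro p a ha b hb
    rw [hA, ← mul_assoc, (hA _ _).1 ha]
  · intro p q
    apply le_antisymm
    · rw [Submodule.span_le]
      rintro _ ⟨a, ha, b, hb, rfl⟩
      have : Coalgebra.comul (R := k) a * ((1 : H) ⊗ₜ[k] b) =
          (e p ⊗ₜ[k] e q) * (Coalgebra.comul (R := k) a * ((1 : H) ⊗ₜ[k] b)) := by
        conv_lhs => rw [← (hA _ _).1 ha, hcen, ← (hA _ _).1 hb, Bialgebra.comul_mul, mul_assoc,
          ← one_mul (1 : H), ← Algebra.TensorProduct.tmul_mul_tmul,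
          ← mul_assoc (Coalgebra.comul (R := k) (e (p * q))), hcom, ← mul_assoc, ← hcen2,
          mul_assoc]
      rw [this]
      exact aux_mem _ _ (hid p) (hid q) _ _ (hA p) (hA q) _
    · rw [Submodule.span_le]
      rintro _ ⟨x, hx, y, hy, rfl⟩
      have h : x ⊗ₜ[k] y = ∑ i ∈ (Coalgebra.Repr.arbitrary k x).index,
          Coalgebra.comul (R := k) ((Coalgebra.Repr.arbitrary k x).left i * e (p * q)) *
          ((1 : H) ⊗ₜ[k] (e q * (HopfAlgebra.antipode k ((Coalgebra.Repr.arbitrary k x).right i)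
            * y))) := by
        have h0 : x ⊗ₜ[k] y = (e p ⊗ₜ[k] e q) * (x ⊗ₜ[k] 1) * (1 ⊗ₜ[k] y) := by
          rw [Algebra.TensorProduct.tmul_mul_tmul, Algebra.TensorProduct.tmul_mul_tmul,
            (hA _ _).1 hx, mul_one, mul_one, (hA _ _).1 hy]
        rw [h0, ← aux_right x (Coalgebra.Repr.arbitrary k x), Finset.mul_sum, Finset.sum_mul]
        refine Finset.sum_congr rfl fun i _ => ?_
        rw [← mul_assoc (e p ⊗ₜ[k] e q), hcen2, ← hcom, Bialgebra.comul_mul]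
        simp only [mul_assoc, Algebra.TensorProduct.tmul_mul_tmul, one_mul]
      rw [h]
      refine Submodule.sum_mem _ fun i _ => Submodule.subset_span ⟨_, ?_, _, ?_, rfl⟩
      · rw [hA, hcen, mul_assoc, hid]
      · rw [hA, ← mul_assoc, hid]
  · intro p q
    apply le_antisymm
    · rw [Submodule.span_le]
      rintro _ ⟨c, hc, a, ha, rfl⟩
      have : (c ⊗ₜ[k] (1 : H)) * Coalgebra.comul (R := k) a =
          (e p ⊗ₜ[k] e q) * ((c ⊗ₜ[k] (1 : H)) * Coalgebra.comul (R := k) a) := by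
        conv_lhs => rw [← (hA _ _).1 ha, ← (hA _ _).1 hc, hcen p c, Bialgebra.comul_mul,
          ← one_mul (1 : H), ← Algebra.TensorProduct.tmul_mul_tmul, mul_assoc,
          ← mul_assoc (e p ⊗ₜ[k] 1)]
        have h3 : (e p ⊗ₜ[k] (1 : H)) * Coalgebra.comul (R := k) (e (p * q)) =
            e p ⊗ₜ[k] e q := by
          rw [← hcom2]
          have : ∀ z : H ⊗[k] H, (e p ⊗ₜ[k] (1 : H)) * z = z * (e p ⊗ₜ[k] (1 : H)) := by
            intro z
            induction z using TensorProduct.induction_on with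
            | zero => simp
            | tmul a b => simp [hcen]
            | add a b ha hb => rw [mul_add, add_mul, ha, hb]
          exact this _
        rw [h3, ← mul_assoc, ← hcen2, mul_assoc]
      rw [this]
      exact aux_mem _ _ (hid p) (hid q) _ _ (hA p) (hA q) _
    · rw [Submodule.span_le]
      rintro _ ⟨x, hx, y, hy, rfl⟩
      have h : x ⊗ₜ[k] y = ∑ i ∈ (Coalgebra.Repr.arbitrary k y).index,
          ((x * HopfAlgebra.antipode k ((Coalgebra.Repr.arbitrary k y).left i) * e p) ⊗ₜ[k] (1 : H))
          * Coalgebra.comul (R := k) ((Coalgebra.Repr.arbitrary k y).right i * e (p * q)) := by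
        have h0 : x ⊗ₜ[k] y = (x ⊗ₜ[k] 1) * (1 ⊗ₜ[k] y) * (e p ⊗ₜ[k] e q) := by
          rw [Algebra.TensorProduct.tmul_mul_tmul, Algebra.TensorProduct.tmul_mul_tmul,
            mul_one, one_mul, ← hcen, ← hcen, (hA _ _).1 hx, (hA _ _).1 hy]
        rw [h0, ← aux_left y (Coalgebra.Repr.arbitrary k y), Finset.mul_sum, Finset.sum_mul]
        refine Finset.sum_congr rfl fun i _ => ?_
        have h4 : ∀ z : H ⊗[k] H, (e p ⊗ₜ[k] (1 : H)) * z = z * (e p ⊗ₜ[k] (1 : H)) := by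
          intro z
          induction z using TensorProduct.induction_on with
          | zero => simp
          | tmul a b => simp [hcen]
          | add a b ha hb => rw [mul_add, add_mul, ha, hb]
        have h5 : ∀ w : H, ((w * e p) ⊗ₜ[k] (1 : H)) =
            (w ⊗ₜ[k] (1 : H)) * (e p ⊗ₜ[k] (1 : H)) := by
          intro w; simp
        have h6 : ∀ v w : H, ((v * w) ⊗ₜ[k] (1 : H)) =
            (v ⊗ₜ[k] (1 : H)) * (w ⊗ₜ[k] (1 : H)) := by
          intro v w; simp
        rw [h5, mul_assoc _ (e p ⊗ₜ[k] (1 : H)), h4, Bialgebra.comul_mul,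
          mul_assoc _ _ (e p ⊗ₜ[k] (1 : H)), hcom2, h6]
        simp only [mul_assoc]
      rw [h]
      refine Submodule.sum_mem _ fun i _ => Submodule.subset_span ⟨_, ?_, _, ?_, rfl⟩
      · rw [hA, hcen, mul_assoc, hid]
      · rw [hA, hcen, mul_assoc, hid]
  · intro p hp
    apply hne p
    have : e p ∈ A p := (hA _ _).2 (hid p)
    change A p = ⊥ at hp
    rw [hp] at this
    exact (Submodule.mem_bot k).1 this

theorem aux_forward (c : GCograding k G H) (hc : ∀ p : G, c.comp p ≠ ⊥) :
    ∃ e : G → H, (∀ p a, e p * a = a * e p) ∧ (∀ p, e p * e p = e p) ∧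
      (∀ p q, p ≠ q → e p * e q = 0) ∧ (∑ p, e p = 1) ∧ (∀ p, e p ≠ 0) ∧
      (∀ r, Coalgebra.comul (R := k) (e r) =
        ∑ p, ∑ q, if p * q = r then e p ⊗ₜ[k] e q else 0) := by
  have hdec : ∀ a : H, ∃ x : G → H, (∀ p, x p ∈ c.comp p) ∧ ∑ p, x p = a := by
    intro a
    classical
    obtain ⟨x, hx⟩ := c.internal.2 a
    refine ⟨fun p => x p, fun p => (x p).2, ?_⟩
    rw [← hx, DirectSum.coeAddMonoidHom_eq_dfinsuppSum, DFinsupp.sum_eq_sum_fintype]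
    · rfl
    · intro i; rfl
  obtain ⟨e, hmem, hsum⟩ := hdec 1
  have hl : ∀ p, ∀ a ∈ c.comp p, e p * a = a := by
    intro p a ha
    conv_rhs => rw [← one_mul a, ← hsum, Finset.sum_mul]
    rw [Finset.sum_eq_single p]
    · intro q _ hq; exact c.mul_eq_zero q p hq _ (hmem q) _ ha
    · simp
  have hr : ∀ p, ∀ a ∈ c.comp p, a * e p = a := by
    intro p a ha
    conv_rhs => rw [← mul_one a, ← hsum, Finset.mul_sum]
    rw [Finset.sum_eq_single p]
    · intro q _ hq; exact c.mul_eq_zero p q hq.symm _ ha _ (hmem q)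
    · simp
  have horth : ∀ p q, p ≠ q → e p * e q = 0 := fun p q h =>
    c.mul_eq_zero p q h _ (hmem p) _ (hmem q)
  have hone : (1 : H ⊗[k] H) = ∑ p, ∑ q, e p ⊗ₜ[k] e q := by
    simp only [← TensorProduct.tmul_sum, ← TensorProduct.sum_tmul, hsum]
    rfl
  have hzero : ∀ r p q, p * q ≠ r →
      Coalgebra.comul (R := k) (e r) * (e p ⊗ₜ[k] e q) = 0 := by
    intro r p q hne
    have hm : Coalgebra.comul (R := k) (e r) * ((1 : H) ⊗ₜ[k] e q) ∈ Submodule.span k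
        {z : H ⊗[k] H | ∃ x ∈ c.comp (r * q⁻¹), ∃ y ∈ c.comp q, z = x ⊗ₜ[k] y} := by
      rw [← c.comul_right]
      refine Submodule.subset_span ⟨e r, ?_, e q, hmem q, rfl⟩
      simpa using hmem r
    have hz : ∀ z ∈ Submodule.span k
        {z : H ⊗[k] H | ∃ x ∈ c.comp (r * q⁻¹), ∃ y ∈ c.comp q, z = x ⊗ₜ[k] y},
        z * (e p ⊗ₜ[k] (1 : H)) = 0 := by
      intro z hz
      induction hz using Submodule.span_induction with
      | mem z h =>
        obtain ⟨x, hx, y, hy, rfl⟩ := h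
        rw [Algebra.TensorProduct.tmul_mul_tmul,
          c.mul_eq_zero _ p (fun h => hne (by rw [← h]; simp)) _ hx _ (hmem p)]
        simp
      | zero => simp
      | add a b _ _ ha hb => rw [add_mul, ha, hb, add_zero]
      | smul t a _ ha => rw [smul_mul_assoc, ha, smul_zero]
    have := hz _ hm
    rw [mul_assoc, Algebra.TensorProduct.tmul_mul_tmul, one_mul, mul_one] at this
    exact this
  have heq : ∀ p q, Coalgebra.comul (R := k) (e (p * q)) * (e p ⊗ₜ[k] e q) = e p ⊗ₜ[k] e q := by
    intro p q
    conv_rhs => rw [← one_mul (e p ⊗ₜ[k] e q), ← Bialgebra.comul_one (R := k) (A := H), ← hsum,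
      map_sum, Finset.sum_mul]
    rw [Finset.sum_eq_single (p * q)]
    · intro r _ hr; exact hzero r p q hr.symm
    · simp
  refine ⟨e, ?_, fun p => hl p _ (hmem p), horth, hsum, ?_, ?_⟩
  · intro p a
    obtain ⟨x, hx, rfl⟩ := hdec a
    rw [Finset.mul_sum, Finset.sum_mul]
    refine Finset.sum_congr rfl fun q _ => ?_
    by_cases h : p = q
    · subst h; rw [hl _ _ (hx p), hr _ _ (hx p)]
    · rw [c.mul_eq_zero p q h _ (hmem p) _ (hx q),
        c.mul_eq_zero q p (Ne.symm h) _ (hx q) _ (hmem p)]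
  · intro p hp
    apply hc p
    rw [eq_bot_iff]
    intro a ha
    rw [Submodule.mem_bot, ← hl p a ha, hp, zero_mul]
  · intro r
    conv_lhs => rw [← mul_one (Coalgebra.comul (R := k) (e r)), hone]
    simp only [Finset.mul_sum]
    refine Finset.sum_congr rfl fun p _ => Finset.sum_congr rfl fun q _ => ?_
    split_ifs with h
    · subst h; exact heq p q
    · exact hzero r p q h

end Aux

/-- a Hopf algebra `H` admits a `G`-cograding with nonzero components
iff there is an injective unital central algebra embedding `γ : (G → k) → H` that
intertwines the comultiplications. -/
theorem cograding_iff_central_embedding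
    {k : Type*} [Field k] {G : Type*} [Group G] [DecidableEq G] [Fintype G]
    {H : Type*} [Ring H] [HopfAlgebra k H] :
    (∃ c : GCograding k G H, ∀ p : G, c.comp p ≠ ⊥) ↔
      ∃ γ : (G → k) →ₐ[k] H, Function.Injective γ ∧
        (∀ f : G → k, γ f ∈ Subalgebra.center k H) ∧
        (∀ f : G → k,
          Coalgebra.comul (R := k) (γ f)
            = ∑ p : G, ∑ q : G,
                f (p * q) • (γ (Pi.single p 1) ⊗ₜ[k] γ (Pi.single q 1))) := by
  constructor
  · rintro ⟨c, hc⟩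
    obtain ⟨e, hcen, hid, horth, hsum, hne, hcom⟩ := aux_forward c hc
    let L : (G → k) →ₗ[k] H :=
      { toFun := fun f => ∑ p, f p • e p
        map_add' := fun f g => by simp [add_smul, Finset.sum_add_distrib]
        map_smul' := fun t f => by simp [mul_smul, Finset.smul_sum] }
    have hL : ∀ f, L f = ∑ p, f p • e p := fun f => rfl
    have hmule : ∀ f p, L f * e p = f p • e p := by
      intro f p
      rw [hL, Finset.sum_mul, Finset.sum_eq_single p]
      · rw [smul_mul_assoc, hid]
      · intro q _ hq; rw [smul_mul_assoc, horth _ _ hq, smul_zero]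
      · simp
    let γ : (G → k) →ₐ[k] H := AlgHom.ofLinearMap L (by simp [hL, hsum]) (by
      intro f g
      rw [hL g, Finset.mul_sum, hL]
      refine Finset.sum_congr rfl fun p _ => ?_
      rw [mul_smul_comm, hmule, smul_smul, Pi.mul_apply, mul_comm])
    have hγ : ∀ f, γ f = L f := fun f => rfl
    have hs : ∀ p, γ (Pi.single p 1) = e p := by
      intro p
      rw [hγ, hL, Finset.sum_eq_single p]
      · simp
      · intro q _ hq; simp [hq]
      · simp
    refine ⟨γ, ?_, ?_, ?_⟩
    · intro f g hfg
      ext p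
      rw [hγ, hγ] at hfg
      have h := hmule f p
      rw [hfg, hmule] at h
      exact (smul_left_injective k (hne p) h).symm
    · intro f
      rw [Subalgebra.mem_center_iff]
      intro b
      rw [hγ, hL, Finset.mul_sum, Finset.sum_mul]
      refine Finset.sum_congr rfl fun p _ => ?_
      rw [mul_smul_comm, smul_mul_assoc, hcen]
    · intro f
      simp only [hs]
      rw [hγ, hL, map_sum]
      simp only [map_smul, hcom, Finset.smul_sum]
      rw [Finset.sum_comm]
      refine Finset.sum_congr rfl fun p _ => ?_
      rw [Finset.sum_comm]
      refine Finset.sum_congr rfl fun q _ => ?_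
      rw [Finset.sum_eq_single (p * q)]
      · simp
      · intro r _ hr; rw [if_neg hr.symm, smul_zero]
      · simp
  · rintro ⟨γ, hinj, hcen, hcom⟩
    have hid : ∀ p : G, γ (Pi.single p 1) * γ (Pi.single p 1) = γ (Pi.single p 1) := by
      intro p
      rw [← map_mul, ← Pi.single_mul, one_mul]
    have horth : ∀ p q : G, p ≠ q → γ (Pi.single p 1) * γ (Pi.single q 1) = 0 := by
      intro p q h
      rw [← map_mul, ← map_zero γ]
      congr 1
      ext r
      by_cases hr : r = p
      · subst hr; simp [h]
      · simp [hr]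
    refine aux_backward (fun p => γ (Pi.single p 1)) ?_ hid horth ?_ ?_ ?_ ?_
    · intro p a
      exact ((Subalgebra.mem_center_iff.1 (hcen (Pi.single p 1))) a).symm
    · rw [← map_sum, ← map_one γ]
      congr 1
      exact Finset.univ_sum_single (1 : G → k)
    · intro p q
      simp only [hcom, Finset.sum_mul, smul_mul_assoc, Algebra.TensorProduct.tmul_mul_tmul, mul_one]
      rw [Finset.sum_eq_single p, Finset.sum_eq_single q]
      · simp [hid]
      · intro q' _ hq; rw [horth _ _ hq]; simp
      · simp
      · intro p' _ hp
        refine Finset.sum_eq_zero fun q' _ => ?_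
        by_cases hq : q' = q
        · subst hq; simp [Pi.single_apply, hp]
        · rw [horth _ _ hq]; simp
      · simp
    · intro p q
      simp only [hcom, Finset.sum_mul, smul_mul_assoc, Algebra.TensorProduct.tmul_mul_tmul, mul_one]
      rw [Finset.sum_eq_single p, Finset.sum_eq_single q]
      · simp [hid]
      · intro q' _ hq; simp [Pi.single_apply, hq]
      · simp
      · intro p' _ hp
        refine Finset.sum_eq_zero fun q' _ => ?_
        rw [horth _ _ hp]; simp
      · simp
    · intro p h
      rw [← map_zero γ] at h
      have := congrFun (hinj h) p
      simp at this
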